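/- arXiv:1807.09209 — 3 statements merged into one kernel-verified Lean document; each statement's English description precedes it below -/
import Mathlib

section
/- Fix a real number p > 0 and let S¹ denote the circle ℝ/pℤ. Define q : [0, p] × S¹ → S¹ × S¹ by q(t, φ) = (t̄ + φ, φ), where t̄ is the image of t in ℝ/pℤ. Then: (i) q is a surjective quotient map; (ii) the preimage of the diagonal Δ ⊆ S¹ × S¹ under q is exactly {0, p} × S¹, so q maps the boundary of [0, p] × S¹ onto the diagonal, and q(0, φ) = q(p, φ) for all φ ∈ S¹; (iii) q restricts to a homeomorphism from the open cylinder (0, p) × S¹ onto the complement (S¹ × S¹) − Δ of the diagonal. -/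
/-- The map `q : [0, p] × ℝ/pℤ → ℝ/pℤ × ℝ/pℤ`, `q (t, φ) = (t̄ + φ, φ)`. -/
noncomputable def cylinderToTorus (p : ℝ) :
    Set.Icc (0 : ℝ) p × AddCircle p → AddCircle p × AddCircle p :=
  fun x => ((((x.1 : ℝ) : AddCircle p) + x.2, x.2))


theorem cyl_coe_zero (p : ℝ) (hp : 0 < p) (t : ℝ) (ht : t ∈ Set.Icc 0 p) :
    ((t : AddCircle p) = 0) ↔ (t = 0 ∨ t = p) := by
  constructor
  · intro h
    rcases lt_or_eq_of_le ht.2 with h2 | h2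
    · left
      have : Fact (0 < p) := ⟨hp⟩
      exact (AddCircle.coe_eq_zero_iff_of_mem_Ico ⟨ht.1, h2⟩).1 h
    · exact Or.inr h2
  · rintro (rfl | rfl)
    · simp
    · exact AddCircle.coe_period _

/-- for `p > 0`, the map `q (t, φ) = (t̄ + φ, φ)` from `[0, p] × S¹` to
`S¹ × S¹` (where `S¹ = ℝ/pℤ`) is a surjective quotient map; the preimage of the diagonal is
`{0, p} × S¹`, which is mapped onto the diagonal, with `q (0, φ) = q (p, φ)`; and `q`
restricts to a homeomorphism from the open cylinder `(0, p) × S¹` onto the complement of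
the diagonal. -/
theorem stmt3 (p : ℝ) (hp : 0 < p) :
    (Function.Surjective (cylinderToTorus p) ∧
      Topology.IsQuotientMap (cylinderToTorus p))
    ∧
    ((cylinderToTorus p) ⁻¹' Set.diagonal (AddCircle p)
        = {x : Set.Icc (0 : ℝ) p × AddCircle p | (x.1 : ℝ) = 0 ∨ (x.1 : ℝ) = p}
      ∧ (cylinderToTorus p) ''
          {x : Set.Icc (0 : ℝ) p × AddCircle p | (x.1 : ℝ) = 0 ∨ (x.1 : ℝ) = p}
        = Set.diagonal (AddCircle p)
      ∧ ∀ φ : AddCircle p,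
          cylinderToTorus p (⟨0, Set.mem_Icc.mpr ⟨le_rfl, hp.le⟩⟩, φ)
            = cylinderToTorus p (⟨p, Set.mem_Icc.mpr ⟨hp.le, le_rfl⟩⟩, φ))
    ∧
    (∃ h : (Set.Ioo (0 : ℝ) p × AddCircle p) ≃ₜ
        ((Set.diagonal (AddCircle p))ᶜ : Set (AddCircle p × AddCircle p)),
      ∀ x : Set.Ioo (0 : ℝ) p × AddCircle p,
        (h x : AddCircle p × AddCircle p) = ((((x.1 : ℝ) : AddCircle p) + x.2, x.2))) := by
  have : Fact (0 < p) := ⟨hp⟩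
  have hcont : Continuous (cylinderToTorus p) := by
    unfold cylinderToTorus
    have := AddCircle.continuous_mk' p
    exact ((this.comp (continuous_subtype_val.comp continuous_fst)).add continuous_snd).prodMk
      continuous_snd
  have hsurj : Function.Surjective (cylinderToTorus p) := by
    rintro ⟨a, b⟩
    obtain ⟨t, ht, h⟩ := AddCircle.eq_coe_Ico (a - b)
    refine ⟨(⟨t, ht.1, ht.2.le⟩, b), ?_⟩
    simp [cylinderToTorus, h]
  have hpre : (cylinderToTorus p) ⁻¹' Set.diagonal (AddCircle p)
        = {x : Set.Icc (0 : ℝ) p × AddCircle p | (x.1 : ℝ) = 0 ∨ (x.1 : ℝ) = p} := by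
    ext x
    simp only [cylinderToTorus, Set.mem_preimage, Set.mem_diagonal_iff, Set.mem_ofPred_eq,
      add_eq_right]
    exact cyl_coe_zero p hp x.1 x.1.2
  refine ⟨⟨hsurj, (hcont.isClosedMap).isQuotientMap hcont hsurj⟩, ⟨hpre, ?_, ?_⟩, ?_⟩
  · rw [← hpre, Set.image_preimage_eq _ hsurj]
  · intro φ
    simp [cylinderToTorus, AddCircle.coe_period]
  have hne : ∀ t ∈ Set.Ioo 0 p, (t : AddCircle p) ≠ 0 := by
    intro t ht h
    rcases (cyl_coe_zero p hp t ⟨ht.1.le, ht.2.le⟩).1 h with h | h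
    · exact ht.1.ne' h
    · exact ht.2.ne h
  have hmem : ∀ y : AddCircle p, y ≠ 0 → (AddCircle.equivIco p 0 y : ℝ) ∈ Set.Ioo 0 p := by
    intro y hy
    have h1 := (AddCircle.equivIco p 0 y).2
    have h2 : ((AddCircle.equivIco p 0 y : ℝ) : AddCircle p) = y := AddCircle.coe_equivIco
    refine ⟨lt_of_le_of_ne h1.1 ?_, by simpa using h1.2⟩
    intro h0
    rw [← h0] at h2
    exact hy (by rw [← h2]; simp)
  have hsub : ∀ y : ((Set.diagonal (AddCircle p))ᶜ : Set (AddCircle p × AddCircle p)),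
      y.1.1 - y.1.2 ≠ 0 := fun y h => y.2 (sub_eq_zero.1 h)
  refine ⟨{
    toFun := fun x => ⟨(((x.1 : ℝ) : AddCircle p) + x.2, x.2), fun h =>
      hne x.1 x.1.2 (add_eq_right.1 h)⟩
    invFun := fun y => (⟨AddCircle.equivIco p 0 (y.1.1 - y.1.2), hmem _ (hsub y)⟩, y.1.2)
    left_inv := ?_
    right_inv := ?_
    continuous_toFun := ?_
    continuous_invFun := ?_ }, fun x => rfl⟩
  · rintro ⟨⟨t, ht⟩, b⟩
    refine Prod.ext (Subtype.ext ?_) rfl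
    simp only [add_sub_cancel_right]
    rw [AddCircle.equivIco_coe_eq (p := p) (a := 0) (x := t) ⟨ht.1.le, by simpa using ht.2⟩]
  · rintro ⟨⟨a, b⟩, hy⟩
    refine Subtype.ext (Prod.ext ?_ rfl)
    simp only [AddCircle.coe_equivIco, sub_add_cancel]
  · have := AddCircle.continuous_mk' p
    exact Continuous.subtype_mk (((this.comp (continuous_subtype_val.comp continuous_fst)).add
      continuous_snd).prodMk continuous_snd) _
  · refine Continuous.prodMk (Continuous.subtype_mk ?_ _) (by fun_prop)
    refine continuous_subtype_val.comp (continuous_iff_continuousAt.2 fun y => ?_)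
    have h1 : ContinuousAt (AddCircle.equivIco p 0) (y.1.1 - y.1.2) :=
      AddCircle.continuousAt_equivIco p 0 (by simpa using hsub y)
    exact ContinuousAt.comp (f := fun y : ((Set.diagonal (AddCircle p))ᶜ :
      Set (AddCircle p × AddCircle p)) => y.1.1 - y.1.2) h1 (by fun_prop)
end

section
/- For every natural number g and every n ∈ ℕ, the group cohomology Hⁿ(Sp(2g, ℤ); ℚ^{2g}) vanishes, where Sp(2g, ℤ) acts on ℚ^{2g} through its standard representation, i.e., via the inclusion of integer matrices into GL(2g, ℚ). -/
open CategoryTheory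

/-- The standard representation of the integral symplectic group `Sp(2g, ℤ)` on `ℚ^{2g}`,
given by regarding an integral symplectic matrix as a rational matrix acting by matrix
multiplication. -/
noncomputable def sympStdRep (g : ℕ) :
    Representation ℚ (Matrix.symplecticGroup (Fin g) ℤ) ((Fin g ⊕ Fin g) → ℚ) :=
  (Matrix.toLinAlgEquiv'.toAlgHom.toRingHom.toMonoidHom).comp
    ((((Int.castRingHom ℚ).mapMatrix :
        Matrix (Fin g ⊕ Fin g) (Fin g ⊕ Fin g) ℤ →+*
          Matrix (Fin g ⊕ Fin g) (Fin g ⊕ Fin g) ℚ).toMonoidHom).comp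
      (Matrix.symplecticGroup (Fin g) ℤ).subtype)

/-- A central element `z` acts as an endomorphism of every representation. -/
noncomputable def centralHom {k G : Type} [CommRing k] [Group G] (z : G)
    (hz : ∀ x : G, x * z = z * x) (A : Rep.{0} k G) : A ⟶ A :=
  Rep.ofHom ⟨A.ρ z, fun x => by rw [← Rep.ρ_mul, ← Rep.ρ_mul, hz]⟩

theorem centralHom_comm {k G : Type} [CommRing k] [Group G] (z : G)
    (hz : ∀ x : G, x * z = z * x) {A B : Rep.{0} k G} (f : A ⟶ B) :
    centralHom z hz A ≫ f = f ≫ centralHom z hz B := by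
  ext x
  exact Rep.hom_comm_apply f z x

/-- The central element acting on a complex of representations. -/
noncomputable def centralComplexHom {k G : Type} [CommRing k] [Group G] (z : G)
    (hz : ∀ x : G, x * z = z * x) (P : ChainComplex (Rep.{0} k G) ℕ) : P ⟶ P where
  f i := centralHom z hz (P.X i)
  comm' i j _ := centralHom_comm z hz _

noncomputable def centralHomotopy {k G : Type} [CommRing k] [Group G] (z : G)
    (hz : ∀ x : G, x * z = z * x) (P : ProjectiveResolution (Rep.trivial k G k)) :
    Homotopy (centralComplexHom z hz P.complex) (𝟙 P.complex) :=
  ProjectiveResolution.liftHomotopy (𝟙 _) _ _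
    (by
      rw [CategoryTheory.Functor.map_id, Category.comp_id]
      apply HomologicalComplex.to_single_hom_ext
      have h := centralHom_comm z hz (P.π.f 0)
      refine h.trans ?_
      have h1 : centralHom z hz (((ChainComplex.single₀ (Rep.{0} k G)).obj
        (Rep.trivial k G k)).X 0) = 𝟙 _ := by
        ext x
        rfl
      rw [h1, Category.comp_id])
    (by simp)

theorem isZero_of_central {k G : Type} [Field k] [CharZero k] [Group G] (z : G)
    (hz : ∀ x : G, x * z = z * x) (A : Rep.{0} k G) (hA : ∀ a : A, A.ρ z a = -a) (n : ℕ) :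
    Limits.IsZero (groupCohomology A n) := by
  let P := Rep.barResolution k G
  have hzA : centralHom z hz A = -𝟙 A := by
    ext a
    exact hA a
  have key : ∀ (i : ℕ) (f : P.complex.X i ⟶ A), centralHom z hz (P.complex.X i) ≫ f = -f := by
    intro i f
    rw [centralHom_comm, hzA]; simp
  have hsm : ∀ (X : Rep.{0} k G) (f g : X ⟶ A), -f = g + f → f = (-(1/2) : k) • g := by
    intro X f g h
    have : g = (-2 : k) • f := by
      have : g = -f - f := by rw [h]; abel
      rw [this, neg_smul, two_smul]; abel
    rw [this, smul_smul]; norm_num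
  let H := centralHomotopy z hz P
  refine Limits.IsZero.of_iso ?_ (groupCohomologyIso A n P)
  rw [← HomologicalComplex.exactAt_iff_isZero_homology]
  cases n with
  | zero =>
    rw [HomologicalComplex.exactAt_iff' _ 0 0 1 (by simp) (by simp),
      ShortComplex.moduleCat_exact_iff]
    intro (f : P.complex.X 0 ⟶ A) (hf : P.complex.d 1 0 ≫ f = 0)
    refine ⟨0, ?_⟩
    rw [map_zero]
    have h := H.comm 0
    rw [Homotopy.dNext_zero_chainComplex, Homotopy.prevD_chainComplex] at h
    have h2 := congrArg (fun t => t ≫ f) h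
    have h3 : centralHom z hz (P.complex.X 0) ≫ f = 0 + f := by
      refine h2.trans ?_
      simp [hf]
    rw [key] at h3
    have := hsm _ _ _ h3
    rw [smul_zero] at this
    exact this.symm
  | succ n =>
    rw [HomologicalComplex.exactAt_iff' _ n (n+1) (n+2) (by simp) (by simp),
      ShortComplex.moduleCat_exact_iff]
    intro (f : P.complex.X (n+1) ⟶ A) (hf : P.complex.d (n+2) (n+1) ≫ f = 0)
    have h := H.comm (n+1)
    rw [Homotopy.dNext_succ_chainComplex, Homotopy.prevD_chainComplex] at h
    have h2 := congrArg (fun t => t ≫ f) h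
    have h3 : centralHom z hz (P.complex.X (n+1)) ≫ f =
        P.complex.d (n+1) n ≫ (H.hom n (n+1) ≫ f) + f := by
      refine h2.trans ?_
      simp [hf]
    rw [key] at h3
    have := hsm _ _ _ h3
    refine ⟨((-(1/2) : k) • (H.hom n (n+1) ≫ f) : P.complex.X n ⟶ A), ?_⟩
    refine Eq.trans ?_ this.symm
    exact Linear.comp_smul (R := k) (C := Rep.{0} k G) _ _ _ (P.complex.d (n+1) n) _ _

/-- `Hⁿ(Sp(2g, ℤ); ℚ^{2g}) = 0` for all `g` and `n`, where `Sp(2g, ℤ)` acts on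
`ℚ^{2g}` through its standard representation. -/
theorem stmt4 (g n : ℕ) :
    Limits.IsZero (groupCohomology (Rep.of (sympStdRep g)) n) := by
  refine isZero_of_central (⟨-1, by
      rw [SymplecticGroup.mem_iff]; simp⟩ : Matrix.symplecticGroup (Fin g) ℤ) ?_ _ ?_ n
  · intro x
    apply Subtype.ext
    change x.1 * (-1) = (-1) * x.1
    simp
  · intro (a : (Fin g ⊕ Fin g) → ℚ)
    have h : ((Int.castRingHom ℚ).mapMatrix
        (-1 : Matrix (Fin g ⊕ Fin g) (Fin g ⊕ Fin g) ℤ)) = -1 := by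
      rw [map_neg, map_one]
    change Matrix.toLinAlgEquiv' ((Int.castRingHom ℚ).mapMatrix
        (-1 : Matrix (Fin g ⊕ Fin g) (Fin g ⊕ Fin g) ℤ)) a = -a
    rw [h]
    simp
end

section
/- Let G be a group acting by automorphisms on a torsion-free abelian group V. Assume that for every integer N ≥ 1 the invariants of V/NV vanish, i.e.: for every v ∈ V, if for every g ∈ G there exists w ∈ V with g·v − v = N·w, then there exists w ∈ V with v = N·w. Then H¹(G; V) is torsion-free; explicitly: for every 1-cocycle f : G → V and every integer N ≥ 1, if the function g ↦ N·f(g) is a coboundary, then f itself is a coboundary. -/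
/-- If `G` acts by automorphisms on a torsion-free abelian group `V` and the
invariants of `V/NV` vanish for every `N ≥ 1`, then `H¹(G; V)` is torsion-free: a 1-cocycle
`f` such that `N • f` is a coboundary (for some integer `N ≥ 1`) is itself a coboundary. -/
theorem stmt6 (G : Type) [Group G] (V : Type) [AddCommGroup V] [DistribMulAction G V]
    (htf : ∀ (m : ℤ), m ≠ 0 → ∀ v : V, m • v = 0 → v = 0)
    (hinv : ∀ (N : ℤ), 1 ≤ N → ∀ v : V,
      (∀ g : G, ∃ w : V, g • v - v = N • w) → ∃ w : V, v = N • w) :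
    ∀ f : G → V, (∀ g h : G, f (g * h) = f g + g • f h) →
      ∀ (N : ℤ), 1 ≤ N →
        (∃ v : V, ∀ g : G, N • f g = g • v - v) →
        ∃ v : V, ∀ g : G, f g = g • v - v := by
  intro f _ N hN hv
  obtain ⟨v, hv⟩ := hv
  obtain ⟨w, rfl⟩ := hinv N hN v (fun g => ⟨f g, (hv g).symm⟩)
  refine ⟨w, fun g => sub_eq_zero.mp (htf N (by omega) _ ?_)⟩
  have h : g • (N • w) = N • (g • w) :=
    map_zsmul (DistribSMul.toAddMonoidHom V g) N w
  rw [smul_sub, smul_sub, hv g, h, sub_self]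
end
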